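/- (Minimal coupling dresses symmetric components with Wilson operators.) Let O be a linear operator on H that commutes with every Ũ_τ(ρ) (τ ∈ Δ^{p+1}, ρ ∈ Ĝ), and for q ∈ C_p(Ĝ) let O_q = Σ_{k ∈ C_p(Ĝ)} P(k) O P(k − q). Then for every vector v ∈ H satisfying Ũ(k') v = v for all cycles k' ∈ Z_{p+1}(Ĝ), one has 𝒰 O 𝒰† v = Σ_{q ∈ B_p(Ĝ)} O_q Ũ(r(q)) ( Σ_{k ∈ B_p(Ĝ)} P(k) ) v. -/

import Mathlib

open Finset

set_option linter.unusedSectionVars false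

noncomputable section

/-- The Pontryagin dual `Ĝ = Hom(G, ℝ/2πℤ)` of an abelian group `G`,
where `ℝ/2πℤ` is `Real.Angle = AddCircle (2π)`. -/
abbrev PDual (G : Type) [AddCommGroup G] : Type := G →+ Real.Angle

/-- The dual of a finite abelian group is finite (hence all the `∑ᶠ` sums over
(subsets of) chain groups with coefficients in `PDual G` below are honest
finite sums). -/
instance PDual.finite (G : Type) [AddCommGroup G] [Fintype G] : Finite (PDual G) := by
  classical
  set n := Fintype.card G with hn
  have hn0 : 0 < n := Fintype.card_pos
  haveI : Fact (0 < 2 * Real.pi) := ⟨by positivity⟩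
  have hT0 : Set.Finite {θ : AddCircle (2 * Real.pi) | n • θ = 0} := by
    have hU : Set.Finite
        (⋃ d ∈ Finset.Icc 1 n, {θ : AddCircle (2 * Real.pi) | addOrderOf θ = d}) :=
      Set.Finite.biUnion (Finset.Icc 1 n).finite_toSet
        (fun d hd => AddCircle.finite_setOfPred_addOrderOf_eq (2 * Real.pi)
          (by simp only [Finset.coe_Icc, Set.mem_Icc] at hd; exact hd.1))
    refine hU.subset ?_
    intro θ hθ
    have hfin : IsOfFinAddOrder θ := by
      rw [isOfFinAddOrder_iff_nsmul_eq_zero]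
      exact ⟨n, hn0, hθ⟩
    have hdvd : addOrderOf θ ∣ n := addOrderOf_dvd_of_nsmul_eq_zero hθ
    have hpos : 0 < addOrderOf θ := hfin.addOrderOf_pos
    refine Set.mem_iUnion₂.mpr ⟨addOrderOf θ, ?_, rfl⟩
    simp only [Finset.mem_Icc]
    exact ⟨hpos, Nat.le_of_dvd hn0 hdvd⟩
  have hT : Set.Finite {θ : Real.Angle | n • θ = 0} := hT0
  haveI : Finite {θ : Real.Angle | n • θ = 0} := hT.to_subtype
  have hinj : Function.Injective
      (fun (k : G →+ Real.Angle) (g : G) =>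
        (⟨k g, by
          show n • k g = 0
          rw [← map_nsmul, card_nsmul_eq_zero, map_zero]⟩ :
          {θ : Real.Angle | n • θ = 0})) := by
    intro k₁ k₂ h
    ext g
    have := congrFun h g
    simpa [Subtype.ext_iff] using this
  exact Finite.of_injective _ hinj

/-- The well-defined complex exponential `e^{iθ} = cos θ + i sin θ` for `θ ∈ ℝ/2πℤ`. -/
def expA (θ : Real.Angle) : ℂ := Real.Angle.cos θ + Real.Angle.sin θ * Complex.I

variable {G : Type} [AddCommGroup G] [Fintype G]

/-- The pairing `⟨k, φ⟩ = ∑_{σ ∈ Δ} k(σ)(φ(σ))` with values in `ℝ/2πℤ`. -/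
def pairing {Δ : Type} [Fintype Δ] (k : Δ → PDual G) (φ : Δ → G) : Real.Angle :=
  ∑ σ, k σ (φ σ)

/-- The boundary map `∂`, `(∂k')(σ) = ∑_τ s(τ,σ) • k'(τ)`; its image is the
boundary group `B_p(Ĝ)` and its kernel the cycle group `Z_{p+1}(Ĝ)`. -/
def bd {A B : Type} [Fintype A] (s : A → B → ℤ) (k' : A → PDual G) : B → PDual G :=
  fun σ => ∑ τ, s τ σ • k' τ

/-- The coboundary map `δ`, `(δφ)(τ) = ∑_σ s(τ,σ) • φ(σ)`; its kernel is the
cocycle group `Z^p(G)` and its image the coboundary group `B^{p+1}(G)`. -/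
def cb {A B : Type} [Fintype B] (s : A → B → ℤ) (φ : B → G) : A → G :=
  fun τ => ∑ σ, s τ σ • φ σ

variable {H : Type} [NormedAddCommGroup H] [InnerProductSpace ℂ H]
  [FiniteDimensional ℂ H]

/-- The product of a pairwise-commuting finite family of operators. -/
def commProd {ι : Type} [Fintype ι] (f : ι → H →L[ℂ] H)
    (h : ∀ i j, Commute (f i) (f j)) : H →L[ℂ] H :=
  Finset.univ.noncommProd f (fun a _ b _ _ => h a b)

variable {Δp Δp1 : Type} [Fintype Δp] [Fintype Δp1]

/-- `U(φ) = ∏_{σ ∈ Δ^p} U_σ(φ(σ))`. -/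
def Uop (U : Δp → G → H →L[ℂ] H)
    (hU : ∀ σ σ' g g', Commute (U σ g) (U σ' g')) (φ : Δp → G) : H →L[ℂ] H :=
  commProd (fun σ => U σ (φ σ)) fun σ σ' => hU σ σ' _ _

/-- The local factor `|G|⁻¹ ∑_{g ∈ G} e^{−i k(σ)(g)} U_σ(g)` of `P(k)`. -/
def Pfactor (U : Δp → G → H →L[ℂ] H) (k : Δp → PDual G) (σ : Δp) : H →L[ℂ] H :=
  (Fintype.card G : ℂ)⁻¹ • ∑ g : G, expA (-(k σ g)) • U σ g

theorem Pfactor_commute (U : Δp → G → H →L[ℂ] H)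
    (hU : ∀ σ σ' g g', Commute (U σ g) (U σ' g')) (k : Δp → PDual G)
    (σ σ' : Δp) : Commute (Pfactor U k σ) (Pfactor U k σ') := by
  unfold Pfactor
  apply Commute.smul_left
  apply Commute.smul_right
  apply Commute.sum_left
  intro g _
  apply Commute.sum_right
  intro g' _
  exact ((hU σ σ' g g').smul_right _).smul_left _

/-- The projector `P(k) = ∏_{σ ∈ Δ^p} ( |G|⁻¹ ∑_{g ∈ G} e^{−i k(σ)(g)} U_σ(g) )`. -/
def Pop (U : Δp → G → H →L[ℂ] H)
    (hU : ∀ σ σ' g g', Commute (U σ g) (U σ' g')) (k : Δp → PDual G) : H →L[ℂ] H :=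
  commProd (Pfactor U k) (Pfactor_commute U hU k)

/-- `Ũ(k') = ∏_{τ ∈ Δ^{p+1}} Ũ_τ(k'(τ))`. -/
def Utop (Ut : Δp1 → PDual G → H →L[ℂ] H)
    (hUt : ∀ τ τ' ρ ρ', Commute (Ut τ ρ) (Ut τ' ρ')) (k' : Δp1 → PDual G) : H →L[ℂ] H :=
  commProd (fun τ => Ut τ (k' τ)) fun τ τ' => hUt τ τ' _ _

/-- The minimal coupling operator `𝒰 = ∑_{k ∈ B_p(Ĝ)} P(k) Ũ(r(k))`, for a fixed
section `r` of the boundary map. -/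
def MC (s : Δp1 → Δp → ℤ) (U : Δp → G → H →L[ℂ] H)
    (hU : ∀ σ σ' g g', Commute (U σ g) (U σ' g'))
    (Ut : Δp1 → PDual G → H →L[ℂ] H)
    (hUt : ∀ τ τ' ρ ρ', Commute (Ut τ ρ) (Ut τ' ρ'))
    (r : (Δp → PDual G) → (Δp1 → PDual G)) : H →L[ℂ] H :=
  ∑ᶠ k ∈ Set.range (bd (G := G) s), Pop U hU k * Utop Ut hUt (r k)

theorem expA_add (a b : Real.Angle) : expA (a + b) = expA a * expA b := by
  unfold expA
  rw [Real.Angle.cos_add, Real.Angle.sin_add]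
  push_cast
  linear_combination (-(a.sin : ℂ) * b.sin) * Complex.I_sq

theorem expA_zero : expA 0 = 1 := by simp [expA]

theorem expA_star (a : Real.Angle) : star (expA a) = expA (-a) := by
  simp [expA]

theorem expA_inj {a b : Real.Angle} (h : expA a = expA b) : a = b := by
  have hre := congrArg Complex.re h
  have him := congrArg Complex.im h
  simp [expA] at hre him
  induction a using Real.Angle.induction_on with
  | h x =>
    induction b using Real.Angle.induction_on with
    | h y => exact Real.Angle.cos_sin_inj hre him

theorem noncommProd_star_eq {ι : Type} (S : Finset ι) (f g : ι → H →L[ℂ] H)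
    (hf : (S : Set ι).Pairwise (Function.onFun Commute f))
    (hg : (S : Set ι).Pairwise (Function.onFun Commute g))
    (h : ∀ i, star (f i) = g i) :
    star (S.noncommProd f hf) = S.noncommProd g hg := by
  classical
  induction S using Finset.induction_on with
  | empty => rw [Finset.noncommProd_empty, Finset.noncommProd_empty, star_one]
  | insert a S ha ih =>
    rw [Finset.noncommProd_insert_of_notMem _ _ _ _ ha,
      Finset.noncommProd_insert_of_notMem' _ _ _ _ ha, star_mul, ih, h]

theorem commProd_commute {ι : Type} [Fintype ι] (f : ι → H →L[ℂ] H)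
    (hf : ∀ i j, Commute (f i) (f j)) (x : H →L[ℂ] H) (h : ∀ i, Commute x (f i)) :
    Commute x (commProd f hf) :=
  Finset.noncommProd_commute _ _ _ _ fun i _ => h i

theorem commProd_mul {ι : Type} [Fintype ι] (f g : ι → H →L[ℂ] H)
    (hf : ∀ i j, Commute (f i) (f j)) (hg : ∀ i j, Commute (g i) (g j))
    (hfg : ∀ i j, Commute (f i) (g j))
    (h : ∀ i j, Commute (f i * g i) (f j * g j)) :
    commProd f hf * commProd g hg = commProd (fun i => f i * g i) h := by
  unfold commProd
  exact (Finset.noncommProd_mul_distrib f g (fun a _ b _ _ => hf a b)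
    (fun a _ b _ _ => hg a b) (fun a _ b _ _ => (hfg b a).symm)).symm

theorem commProd_zero {ι : Type} [Fintype ι] (f : ι → H →L[ℂ] H)
    (hf : ∀ i j, Commute (f i) (f j)) (i : ι) (h : f i = 0) : commProd f hf = 0 := by
  classical
  have hc : ((Finset.univ : Finset ι) : Set ι).Pairwise (Function.onFun Commute f) :=
    fun a _ b _ _ => hf a b
  have e := Finset.mul_noncommProd_erase Finset.univ (Finset.mem_univ i) f hc
  rw [h, zero_mul] at e
  exact e.symm

theorem Pfactor_commute' (U : Δp → G → H →L[ℂ] H)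
    (hU : ∀ σ σ' g g', Commute (U σ g) (U σ' g')) (k l : Δp → PDual G)
    (σ σ' : Δp) : Commute (Pfactor U k σ) (Pfactor U l σ') := by
  unfold Pfactor
  refine Commute.smul_left (Commute.smul_right ?_ _) _
  refine Commute.sum_left _ _ _ fun g _ => Commute.sum_right _ _ _ fun g' _ => ?_
  exact ((hU σ σ' g g').smul_right _).smul_left _

theorem U_mul_Pfactor (U : Δp → G → H →L[ℂ] H)
    (hUhom : ∀ σ g g', U σ (g + g') = U σ g * U σ g') (k : Δp → PDual G) (σ : Δp) (g : G) :
    U σ g * Pfactor U k σ = expA (k σ g) • Pfactor U k σ := by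
  unfold Pfactor
  rw [mul_smul_comm, smul_comm]
  congr 1
  rw [Finset.mul_sum, Finset.smul_sum, ← Equiv.sum_comp (Equiv.addLeft g)
    (fun x => expA (k σ g) • expA (-(k σ x)) • U σ x)]
  refine Finset.sum_congr rfl fun x _ => ?_
  simp only [Equiv.coe_addLeft, map_add, hUhom, smul_smul, mul_smul_comm]
  rw [← expA_add]
  congr 2
  abel

theorem Pfactor_sq (U : Δp → G → H →L[ℂ] H)
    (hUhom : ∀ σ g g', U σ (g + g') = U σ g * U σ g') (k : Δp → PDual G) (σ : Δp) :
    Pfactor U k σ * Pfactor U k σ = Pfactor U k σ := by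
  conv_lhs => lhs; unfold Pfactor
  rw [smul_mul_assoc, Finset.sum_mul]
  simp only [smul_mul_assoc, U_mul_Pfactor U hUhom, smul_smul, ← expA_add, neg_add_cancel,
    expA_zero, one_smul, Finset.sum_const, Finset.card_univ]
  rw [← Nat.cast_smul_eq_nsmul ℂ, smul_smul, inv_mul_cancel₀, one_smul]
  exact_mod_cast Fintype.card_ne_zero

theorem Pfactor_orth (U : Δp → G → H →L[ℂ] H)
    (hU : ∀ σ σ' g g', Commute (U σ g) (U σ' g'))
    (hUhom : ∀ σ g g', U σ (g + g') = U σ g * U σ g') (k l : Δp → PDual G) (σ : Δp)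
    (h : k σ ≠ l σ) : Pfactor U k σ * Pfactor U l σ = 0 := by
  obtain ⟨g, hg⟩ := DFunLike.ne_iff.mp h
  have h1 : U σ g * (Pfactor U k σ * Pfactor U l σ)
      = expA (k σ g) • (Pfactor U k σ * Pfactor U l σ) := by
    rw [← mul_assoc, U_mul_Pfactor U hUhom, smul_mul_assoc]
  have h2 : U σ g * (Pfactor U k σ * Pfactor U l σ)
      = expA (l σ g) • (Pfactor U k σ * Pfactor U l σ) := by
    rw [(Pfactor_commute' U hU k l σ σ).eq, ← mul_assoc, U_mul_Pfactor U hUhom, smul_mul_assoc]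
  have h3 : (expA (k σ g) - expA (l σ g)) • (Pfactor U k σ * Pfactor U l σ) = 0 := by
    rw [sub_smul, ← h1, ← h2, sub_self]
  rcases smul_eq_zero.mp h3 with h4 | h4
  · exact absurd (expA_inj (sub_eq_zero.mp h4)) hg
  · exact h4

theorem Pfactor_star (U : Δp → G → H →L[ℂ] H)
    (hUhom : ∀ σ g g', U σ (g + g') = U σ g * U σ g') (hU0 : ∀ σ, U σ 0 = 1)
    (hUunit : ∀ σ g, star (U σ g) * U σ g = 1 ∧ U σ g * star (U σ g) = 1)
    (k : Δp → PDual G) (σ : Δp) : star (Pfactor U k σ) = Pfactor U k σ := by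
  have hs : ∀ g, star (U σ g) = U σ (-g) := fun g =>
    left_inv_eq_right_inv (hUunit σ g).1 (by rw [← hUhom, add_neg_cancel, hU0])
  unfold Pfactor
  rw [star_smul, star_sum, ← Equiv.sum_comp (Equiv.neg G)
    (fun x => expA (-(k σ x)) • U σ x)]
  congr 1
  · simp
  · refine Finset.sum_congr rfl fun x _ => ?_
    rw [star_smul, expA_star, hs]
    simp

theorem Pop_star (U : Δp → G → H →L[ℂ] H)
    (hU : ∀ σ σ' g g', Commute (U σ g) (U σ' g'))
    (hUhom : ∀ σ g g', U σ (g + g') = U σ g * U σ g') (hU0 : ∀ σ, U σ 0 = 1)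
    (hUunit : ∀ σ g, star (U σ g) * U σ g = 1 ∧ U σ g * star (U σ g) = 1)
    (k : Δp → PDual G) : star (Pop U hU k) = Pop U hU k :=
  noncommProd_star_eq _ _ _ (fun σ _ σ' _ _ => Pfactor_commute U hU k σ σ')
    (fun σ _ σ' _ _ => Pfactor_commute U hU k σ σ') fun σ => Pfactor_star U hUhom hU0 hUunit k σ

theorem Pop_sq (U : Δp → G → H →L[ℂ] H)
    (hU : ∀ σ σ' g g', Commute (U σ g) (U σ' g'))
    (hUhom : ∀ σ g g', U σ (g + g') = U σ g * U σ g') (k : Δp → PDual G) :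
    Pop U hU k * Pop U hU k = Pop U hU k := by
  have e : (fun σ => Pfactor U k σ * Pfactor U k σ) = Pfactor U k :=
    funext fun σ => Pfactor_sq U hUhom k σ
  unfold Pop
  rw [commProd_mul _ _ _ _ (Pfactor_commute U hU k) (fun i j => by
    rw [Pfactor_sq U hUhom, Pfactor_sq U hUhom]; exact Pfactor_commute U hU k i j)]
  simp only [e]

theorem Pop_orth (U : Δp → G → H →L[ℂ] H)
    (hU : ∀ σ σ' g g', Commute (U σ g) (U σ' g'))
    (hUhom : ∀ σ g g', U σ (g + g') = U σ g * U σ g') (k l : Δp → PDual G) (h : k ≠ l) :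
    Pop U hU k * Pop U hU l = 0 := by
  obtain ⟨σ, hσ⟩ := Function.ne_iff.mp h
  have c := Pfactor_commute' U hU
  unfold Pop
  rw [commProd_mul _ _ _ _ (c k l) (fun i j =>
    ((c k k i j).mul_right (c k l i j)).mul_left ((c l k i j).mul_right (c l l i j)))]
  exact commProd_zero _ _ σ (Pfactor_orth U hU hUhom k l σ hσ)

theorem Utop_add (Ut : Δp1 → PDual G → H →L[ℂ] H)
    (hUt : ∀ τ τ' ρ ρ', Commute (Ut τ ρ) (Ut τ' ρ'))
    (hUthom : ∀ τ ρ ρ', Ut τ (ρ + ρ') = Ut τ ρ * Ut τ ρ') (a b : Δp1 → PDual G) :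
    Utop Ut hUt (a + b) = Utop Ut hUt a * Utop Ut hUt b := by
  unfold Utop
  rw [commProd_mul _ _ _ _ (fun i j => hUt i j _ _) (fun i j => by
    rw [← hUthom, ← hUthom]; exact hUt _ _ _ _)]
  simp only [Pi.add_apply, hUthom]

theorem Utop_star (Ut : Δp1 → PDual G → H →L[ℂ] H)
    (hUt : ∀ τ τ' ρ ρ', Commute (Ut τ ρ) (Ut τ' ρ'))
    (hUthom : ∀ τ ρ ρ', Ut τ (ρ + ρ') = Ut τ ρ * Ut τ ρ')
    (hUt0 : ∀ τ, Ut τ 0 = 1)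
    (hUtunit : ∀ τ ρ, star (Ut τ ρ) * Ut τ ρ = 1 ∧ Ut τ ρ * star (Ut τ ρ) = 1)
    (a : Δp1 → PDual G) : star (Utop Ut hUt a) = Utop Ut hUt (-a) :=
  noncommProd_star_eq _ _ _ (fun τ _ τ' _ _ => hUt τ τ' _ _)
    (fun τ _ τ' _ _ => hUt τ τ' _ _) fun τ =>
    left_inv_eq_right_inv (hUtunit τ (a τ)).1
      (by rw [← hUthom, Pi.neg_apply, add_neg_cancel, hUt0])

theorem Pop_Utop_commute (U : Δp → G → H →L[ℂ] H)
    (hU : ∀ σ σ' g g', Commute (U σ g) (U σ' g'))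
    (Ut : Δp1 → PDual G → H →L[ℂ] H)
    (hUt : ∀ τ τ' ρ ρ', Commute (Ut τ ρ) (Ut τ' ρ'))
    (hmix : ∀ σ τ g ρ, Commute (U σ g) (Ut τ ρ)) (k : Δp → PDual G) (a : Δp1 → PDual G) :
    Commute (Pop U hU k) (Utop Ut hUt a) := by
  refine commProd_commute _ _ _ fun τ => (commProd_commute _ _ _ fun σ => ?_).symm
  unfold Pfactor
  exact Commute.smul_right (Commute.sum_right _ _ _ fun g _ =>
    (hmix σ τ g _).symm.smul_right _) _

theorem bd_add {A B : Type} [Fintype A] (s : A → B → ℤ) (a b : A → PDual G) :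
    bd s (a + b) = bd s a + bd s b := by
  funext σ
  simp [bd, Finset.sum_add_distrib]

theorem bd_sub {A B : Type} [Fintype A] (s : A → B → ℤ) (a b : A → PDual G) :
    bd s (a - b) = bd s a - bd s b := by
  funext σ
  simp [bd, Finset.sum_sub_distrib, smul_sub]

/-- **Minimal coupling dresses symmetric components with Wilson operators**:
if `O` commutes with every `Ũ_τ(ρ)`, then on every vector `v` invariant under
all Wilson operators `Ũ(k')` labelled by cycles `k' ∈ Z_{p+1}(Ĝ)`,
`𝒰 O 𝒰† v = ∑_{q ∈ B_p(Ĝ)} O_q Ũ(r(q)) ( ∑_{k ∈ B_p(Ĝ)} P(k) ) v`,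
where `O_q = ∑_{k ∈ C_p(Ĝ)} P(k) O P(k − q)`. -/
theorem minimal_coupling_dressing
    (s : Δp1 → Δp → ℤ)
    (U : Δp → G → H →L[ℂ] H)
    (hU : ∀ σ σ' g g', Commute (U σ g) (U σ' g'))
    (hUhom : ∀ σ g g', U σ (g + g') = U σ g * U σ g')
    (hU0 : ∀ σ, U σ 0 = 1)
    (hUunit : ∀ σ g, star (U σ g) * U σ g = 1 ∧ U σ g * star (U σ g) = 1)
    (Ut : Δp1 → PDual G → H →L[ℂ] H)
    (hUt : ∀ τ τ' ρ ρ', Commute (Ut τ ρ) (Ut τ' ρ'))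
    (hUthom : ∀ τ ρ ρ', Ut τ (ρ + ρ') = Ut τ ρ * Ut τ ρ')
    (hUt0 : ∀ τ, Ut τ 0 = 1)
    (hUtunit : ∀ τ ρ, star (Ut τ ρ) * Ut τ ρ = 1 ∧ Ut τ ρ * star (Ut τ ρ) = 1)
    (hmix : ∀ σ τ g ρ, Commute (U σ g) (Ut τ ρ))
    (r : (Δp → PDual G) → (Δp1 → PDual G))
    (hr : ∀ k ∈ Set.range (bd (G := G) s), bd s (r k) = k)
    (O : H →L[ℂ] H)
    (hO : ∀ τ ρ, Commute O (Ut τ ρ))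
    (v : H)
    (hv : ∀ k' : Δp1 → PDual G, bd s k' = 0 → Utop Ut hUt k' v = v) :
    (MC s U hU Ut hUt r * O * star (MC s U hU Ut hUt r)) v
      = ((∑ᶠ q ∈ Set.range (bd (G := G) s),
            (∑ᶠ k : Δp → PDual G, Pop U hU k * O * Pop U hU (k - q))
              * Utop Ut hUt (r q))
          * (∑ᶠ k ∈ Set.range (bd (G := G) s), Pop U hU k)) v := by
  classical
  haveI : Fintype (Δp → PDual G) := Fintype.ofFinite _
  set B : Finset (Δp → PDual G) := (Set.range (bd (G := G) s)).toFinset with hB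
  have hmem : ∀ k, k ∈ B ↔ k ∈ Set.range (bd (G := G) s) := fun k => by simp [hB]
  have hfs : ∀ F : (Δp → PDual G) → (H →L[ℂ] H),
      (∑ᶠ k ∈ Set.range (bd (G := G) s), F k) = ∑ k ∈ B, F k := fun F => by
    rw [← finsum_mem_coe_finset]; simp [hB]
  have hadd : ∀ k ∈ B, ∀ l ∈ B, k + l ∈ B := by
    intro k hk l hl
    rw [hmem] at *
    obtain ⟨a, rfl⟩ := hk
    obtain ⟨b, rfl⟩ := hl
    exact ⟨a + b, bd_add s a b⟩
  have hsub : ∀ k ∈ B, ∀ l ∈ B, k - l ∈ B := by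
    intro k hk l hl
    rw [hmem] at *
    obtain ⟨a, rfl⟩ := hk
    obtain ⟨b, rfl⟩ := hl
    exact ⟨a - b, bd_sub s a b⟩
  have hrB : ∀ k ∈ B, bd s (r k) = k := fun k hk => hr k ((hmem k).mp hk)
  have hPW := Pop_Utop_commute U hU Ut hUt hmix
  have hOW : ∀ a, Commute O (Utop Ut hUt a) := fun a =>
    commProd_commute _ _ _ fun τ => hO τ _
  -- the left-hand side
  have hL : (MC s U hU Ut hUt r * O * star (MC s U hU Ut hUt r)) v
      = ∑ l ∈ B, ∑ k ∈ B, (Pop U hU k * O * Pop U hU l) (Utop Ut hUt (r (k - l)) v) := by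
    have e : MC s U hU Ut hUt r * O * star (MC s U hU Ut hUt r)
        = ∑ l ∈ B, ∑ k ∈ B, Pop U hU k * O * Pop U hU l * Utop Ut hUt (r k + -r l) := by
      unfold MC
      rw [hfs, star_sum, Finset.mul_sum]
      refine Finset.sum_congr rfl fun l _ => ?_
      rw [Finset.sum_mul, Finset.sum_mul]
      refine Finset.sum_congr rfl fun k _ => ?_
      rw [star_mul, Pop_star U hU hUhom hU0 hUunit, Utop_star Ut hUt hUthom hUt0 hUtunit,
        Utop_add Ut hUt hUthom, ← (hPW l (-r l)).eq]
      calc _ = Pop U hU k * (Utop Ut hUt (r k) * O) * Pop U hU l * Utop Ut hUt (-r l) := by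
              simp only [mul_assoc]
        _ = Pop U hU k * O * (Utop Ut hUt (r k) * Pop U hU l) * Utop Ut hUt (-r l) := by
              rw [← (hOW _).eq]; simp only [mul_assoc]
        _ = _ := by rw [← (hPW _ _).eq]; simp only [mul_assoc]
    rw [e]
    simp only [_root_.sum_apply]
    refine Finset.sum_congr rfl fun l hl => Finset.sum_congr rfl fun k hk => ?_
    have e2 : r k + -r l = r (k - l) + (r k - r l - r (k - l)) := by abel
    have e3 : Utop Ut hUt (r k - r l - r (k - l)) v = v := by
      apply hv
      rw [bd_sub, bd_sub, hrB k hk, hrB l hl, hrB _ (hsub k hk l hl), sub_self]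
    rw [e2, Utop_add Ut hUt hUthom]
    change (Pop U hU k * O * Pop U hU l) (Utop Ut hUt (r (k - l))
      (Utop Ut hUt (r k - r l - r (k - l)) v)) = _
    rw [e3]
  have hR : ((∑ᶠ q ∈ Set.range (bd (G := G) s),
            (∑ᶠ k : Δp → PDual G, Pop U hU k * O * Pop U hU (k - q))
              * Utop Ut hUt (r q))
          * (∑ᶠ k ∈ Set.range (bd (G := G) s), Pop U hU k))
      = ∑ l ∈ B, ∑ q ∈ B, Pop U hU (l + q) * O * Pop U hU l * Utop Ut hUt (r q) := by
    rw [hfs, hfs, Finset.mul_sum]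
    refine Finset.sum_congr rfl fun l _ => ?_
    rw [Finset.sum_mul]
    refine Finset.sum_congr rfl fun q _ => ?_
    rw [finsum_eq_sum_of_fintype, mul_assoc, ← (hPW _ _).eq, ← mul_assoc, Finset.sum_mul]
    congr 1
    rw [Finset.sum_eq_single (l + q)]
    · rw [add_sub_cancel_right, mul_assoc, Pop_sq U hU hUhom]
    · intro k _ hk
      rw [mul_assoc, Pop_orth U hU hUhom, mul_zero]
      intro h
      exact hk (by rw [← h, sub_add_cancel])
    · simp
  rw [hL, hR]
  simp only [_root_.sum_apply]
  refine Finset.sum_congr rfl fun l hl => ?_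
  refine Finset.sum_bij' (fun k _ => k - l) (fun q _ => l + q)
    (fun k hk => hsub k hk l hl) (fun q hq => hadd l hl q hq) ?_ ?_ ?_
  · intro k _; abel
  · intro q _; abel
  · intro k _
    rw [add_sub_cancel]
    rfl
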